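/- Let Σ = ∂U be the closed C³ boundary of an open domain U ⊂ ℝⁿ, let h : U → ℝ₊ be the distance to Σ (a C² function on the corona ω = { x ∈ U : h(x) < L }, L = L(Σ)), and let π(x) = x − h(x)∇h(x) denote the projection onto Σ. For x ∈ ω with a = π(x), the bilinear norm of the Hessian of h satisfies h(x)·|D²h_x|_bil = | h(x) dν_a ( Id_{T_aΣ} − h(x) dν_a )^{-1} |_op, where dν_a is the curvature tensor (differential of the unit normal field) at a. In particular, h·|D²h|_bil ≤ 1 and |dσ|_op ≤ 3 hold throughout the sub-corona ω_{1/2} = { x ∈ U : 0 < d(x;Σ) < L/2 }, where σ(x) = x − 2h(x)∇h(x) is the reflection across Σ. -/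

import Mathlib

open MeasureTheory Metric Set Filter Topology
open scoped Pointwise ENNReal NNReal

noncomputable section

abbrev Euc (n : ℕ) := EuclideanSpace ℝ (Fin n)

/-- Integral of a real function against a signed measure. -/
def sInt {α : Type*} [MeasurableSpace α] (μ : MeasureTheory.SignedMeasure α) (f : α → ℝ) : ℝ :=
  ∫ x, f x ∂μ.toJordanDecomposition.posPart - ∫ x, f x ∂μ.toJordanDecomposition.negPart

/-- A signed measure is concentrated on the set `S`. -/
def SuppOn {α : Type*} [MeasurableSpace α] (μ : MeasureTheory.SignedMeasure α) (S : Set α) : Prop :=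
  ∀ t : Set α, MeasurableSet t → t ∩ S = ∅ → μ t = 0

/-- Total variation mass of a finite family of signed measures, seen as a vector measure,
via duality against continuous fields of pointwise Euclidean norm at most one. -/
def vmass {α : Type*} [MeasurableSpace α] [TopologicalSpace α] {ι : Type*} [Fintype ι]
    (g : ι → MeasureTheory.SignedMeasure α) : ℝ :=
  sSup { r | ∃ Y : ι → α → ℝ, (∀ i, Continuous (Y i)) ∧ (∀ x, ∑ i, (Y i x) ^ 2 ≤ 1) ∧
      r = ∑ i, sInt (g i) (Y i) }

/-- `j`-th partial derivative. -/
def pd {n : ℕ} (j : Fin n) (ψ : Euc n → ℝ) (x : Euc n) : ℝ :=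
  fderiv ℝ ψ x (EuclideanSpace.single j 1)

/-- Smooth test function compactly supported in `U`. -/
def IsTestFun {n : ℕ} (U : Set (Euc n)) (ψ : Euc n → ℝ) : Prop :=
  ContDiff ℝ (⊤ : ℕ∞) ψ ∧ HasCompactSupport ψ ∧ tsupport ψ ⊆ U

/-- A `C¹` function with compact support (representing an element of `C¹(Ū)`). -/
def IsC1 {n : ℕ} (Y : Euc n → ℝ) : Prop := ContDiff ℝ 1 Y ∧ HasCompactSupport Y

/-- A symmetric Div-BV tensor on `U`: the entries and the row-wise distributional
divergence are finite (signed) Radon measures carried by `U`. -/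
structure DivBV (n : ℕ) (U : Set (Euc n)) where
  A : Fin n → Fin n → MeasureTheory.SignedMeasure (Euc n)
  divA : Fin n → MeasureTheory.SignedMeasure (Euc n)
  symm : ∀ i j, A i j = A j i
  suppA : ∀ i j, SuppOn (A i j) U
  suppDiv : ∀ i, SuppOn (divA i) U
  weak : ∀ i, ∀ ψ : Euc n → ℝ, IsTestFun U ψ →
    ∑ j, sInt (A i j) (pd j ψ) = - sInt (divA i) ψ

/-- Positive semi-definiteness of a matrix of measures. -/
def DivBV.PSD {n : ℕ} {U : Set (Euc n)} (T : DivBV n U) : Prop :=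
  ∀ ξ : Fin n → ℝ, ∀ s : Set (Euc n), MeasurableSet s →
    0 ≤ ∑ i, ∑ j, ξ i * ξ j * (T.A i j) s

/-- Density (Radon–Nikodym derivative w.r.t. Lebesgue) of a signed measure. -/
def sdens {n : ℕ} (μ : MeasureTheory.SignedMeasure (Euc n)) (x : Euc n) : ℝ :=
  (μ.toJordanDecomposition.posPart.rnDeriv volume x).toReal -
  (μ.toJordanDecomposition.negPart.rnDeriv volume x).toReal

/-- Pointwise determinant of the absolutely continuous part of a Div-BV tensor. -/
def DivBV.detDens {n : ℕ} {U : Set (Euc n)} (T : DivBV n U) (x : Euc n) : ℝ :=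
  Matrix.det (Matrix.of fun i j => sdens (T.A i j) x)

/-- Total mass `‖A‖_{M(U)}` of the tensor. -/
def DivBV.massA {n : ℕ} {U : Set (Euc n)} (T : DivBV n U) : ℝ :=
  vmass (fun p : Fin n × Fin n => T.A p.1 p.2)

/-- Total mass `‖Div A‖_{M(U)}` of the divergence. -/
def DivBV.massDiv {n : ℕ} {U : Set (Euc n)} (T : DivBV n U) : ℝ :=
  vmass T.divA

/-- The pairing `⟨A, ∇Y⟩_U + ⟨Div A, Y⟩_U` defining the normal trace `γ_ν A`. -/
def DivBV.tracePair {n : ℕ} {U : Set (Euc n)} (T : DivBV n U) (Y : Fin n → Euc n → ℝ) : ℝ :=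
  (∑ i, ∑ j, sInt (T.A i j) (pd j (Y i))) + ∑ i, sInt (T.divA i) (Y i)

/-- The normal trace `γ_ν A` is represented by the vector-valued measure `g` on `∂U`. -/
def DivBV.TraceMeas {n : ℕ} {U : Set (Euc n)} (T : DivBV n U)
    (g : Fin n → MeasureTheory.SignedMeasure (Euc n)) : Prop :=
  (∀ i, SuppOn (g i) (frontier U)) ∧
  ∀ Y : Fin n → Euc n → ℝ, (∀ i, IsC1 (Y i)) →
    T.tracePair Y = ∑ i, sInt (g i) (Y i)

/-- The tangential part `γ_ν^τ A` of the normal trace is represented by the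
vector-valued measure `g` on `∂U` (with outer unit normal field `ν`): `g` is carried by `∂U`,
is tangential, and represents the trace pairing against all `C¹` fields tangential along `∂U`. -/
def DivBV.TangTraceMeas {n : ℕ} {U : Set (Euc n)} (T : DivBV n U) (ν : Euc n → Euc n)
    (g : Fin n → MeasureTheory.SignedMeasure (Euc n)) : Prop :=
  (∀ i, SuppOn (g i) (frontier U)) ∧
  (∀ φ : Euc n → ℝ, Continuous φ → ∑ i, sInt (g i) (fun x => φ x * ν x i) = 0) ∧
  ∀ Y : Fin n → Euc n → ℝ, (∀ i, IsC1 (Y i)) →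
    (∀ x ∈ frontier U, ∑ i, Y i x * ν x i = 0) →
    T.tracePair Y = ∑ i, sInt (g i) (Y i)

/-- A domain whose boundary is a `C^k` hypersurface, presented by a defining function. -/
structure CkDomain (n k : ℕ) (U : Set (Euc n)) where
  f : Euc n → ℝ
  O : Set (Euc n)
  opO : IsOpen O
  front : frontier U ⊆ O
  smooth : ContDiffOn ℝ k f O
  grad_ne : ∀ x ∈ frontier U, gradient f x ≠ 0
  neg : ∀ x ∈ O ∩ U, f x < 0
  pos : ∀ x ∈ O \ closure U, 0 < f x
  zero : ∀ x ∈ frontier U, f x = 0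

/-- The outer unit normal field (normalized gradient of the defining function). -/
def CkDomain.nu {n k : ℕ} {U : Set (Euc n)} (B : CkDomain n k U) (x : Euc n) : Euc n :=
  ‖gradient B.f x‖⁻¹ • gradient B.f x

/-- `L(Σ)`: the largest `L` such that every point at distance `< L` of `Σ` has a unique
nearest point on `Σ`. -/
def uniqRadius {n : ℕ} (S : Set (Euc n)) : ℝ :=
  sSup { L : ℝ | 0 ≤ L ∧ ∀ x : Euc n, infDist x S < L →
    ∃! a, a ∈ S ∧ dist x a = infDist x S }

open Classical in
/-- Nearest-point projection on `S` (junk value if no nearest point exists). -/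
def nearestPt {n : ℕ} (S : Set (Euc n)) (x : Euc n) : Euc n :=
  if h : ∃ a, a ∈ S ∧ dist x a = infDist x S then h.choose else x

/-- The geometric extension `ν ∘ π_Σ` of the unit normal to a tubular neighbourhood. -/
def CkDomain.nuGeo {n k : ℕ} {U : Set (Euc n)} (B : CkDomain n k U) (x : Euc n) : Euc n :=
  B.nu (nearestPt (frontier U) x)

/-- `K(Σ) = max (1/L(Σ), L(Σ) ‖D²ν‖_∞)`. -/
def CkDomain.Kconst {n k : ℕ} {U : Set (Euc n)} (B : CkDomain n k U) : ℝ :=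
  max (uniqRadius (frontier U))⁻¹
    (uniqRadius (frontier U) *
      sSup ((fun a => ‖fderiv ℝ (fderiv ℝ B.nuGeo) a‖) '' frontier U))

/-- The reflection `σ(x) = 2π_Σ(x) − x` across `Σ`. -/
def reflAcross {n : ℕ} (S : Set (Euc n)) (x : Euc n) : Euc n :=
  (2 : ℝ) • nearestPt S x - x


section Projection

variable {n : ℕ} {S : Set (Euc n)}

theorem existsUnique_of_infDist_lt {x : Euc n} (h : infDist x S < uniqRadius S) :
    ∃! a, a ∈ S ∧ dist x a = infDist x S := by
  have hne : { L : ℝ | 0 ≤ L ∧ ∀ x : Euc n, infDist x S < L →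
      ∃! a, a ∈ S ∧ dist x a = infDist x S }.Nonempty := by
    rw [Set.nonempty_iff_ne_empty]
    intro he
    rw [uniqRadius, he, Real.sSup_empty] at h
    exact absurd h (not_lt.2 infDist_nonneg)
  obtain ⟨L, hL, hxL⟩ := exists_lt_of_lt_csSup hne h
  exact hL.2 x hxL

theorem nearestPt_spec (hS : IsCompact S) (hne : S.Nonempty) (x : Euc n) :
    nearestPt S x ∈ S ∧ dist x (nearestPt S x) = infDist x S := by
  have h : ∃ a, a ∈ S ∧ dist x a = infDist x S := by
    obtain ⟨a, ha, hd⟩ := hS.exists_infDist_eq_dist hne x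
    exact ⟨a, ha, hd.symm⟩
  rw [nearestPt, dif_pos h]
  exact h.choose_spec

theorem nearestPt_eq (hS : IsCompact S) (hne : S.Nonempty) {x a : Euc n}
    (h : infDist x S < uniqRadius S) (ha : a ∈ S) (hd : dist x a = infDist x S) :
    nearestPt S x = a :=
  (existsUnique_of_infDist_lt h).unique (nearestPt_spec hS hne x) ⟨ha, hd⟩

theorem nearestPt_of_mem (hS : IsCompact S) (hne : S.Nonempty) {a : Euc n} (ha : a ∈ S) :
    nearestPt S a = a := by
  have h := (nearestPt_spec hS hne a).2
  rw [infDist_zero_of_mem ha] at h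
  exact (dist_eq_zero.1 h).symm

theorem continuousAt_nearestPt (hS : IsCompact S) (hne : S.Nonempty) {x : Euc n}
    (h : infDist x S < uniqRadius S) : ContinuousAt (nearestPt S) x := by
  refine hS.tendsto_nhds_of_unique_mapClusterPt
    (Eventually.of_forall fun z => (nearestPt_spec hS hne z).1) fun b hb hcl => ?_
  refine (nearestPt_eq hS hne h hb ?_).symm
  have h1 : MapClusterPt (dist x b) (𝓝 x) ((fun c => dist x c) ∘ nearestPt S) :=
    hcl.continuousAt_comp (by fun_prop)
  have h2 : Tendsto ((fun c => dist x c) ∘ nearestPt S) (𝓝 x) (𝓝 (infDist x S)) := by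
    have hlow : ∀ z, infDist x S ≤ dist x (nearestPt S z) := fun z =>
      infDist_le_dist_of_mem (nearestPt_spec hS hne z).1
    have hup : ∀ z, dist x (nearestPt S z) ≤ dist x z + infDist z S := fun z => by
      rw [← (nearestPt_spec hS hne z).2]
      exact dist_triangle _ _ _
    refine tendsto_of_tendsto_of_tendsto_of_le_of_le tendsto_const_nhds ?_ hlow hup
    have hc : Continuous fun z => dist x z + infDist z S :=
      (continuous_const.dist continuous_id).add (continuous_infDist_pt S)
    simpa using hc.tendsto x
  have h3 : ClusterPt (dist x b) (𝓝 (infDist x S)) := ClusterPt.mono h1 h2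
  exact eq_of_nhds_neBot h3

/-- Away from `S`, the distance to `S` increases at almost unit rate in a suitable direction. -/
theorem exists_infDist_add_ge (hS : IsCompact S) (hne : S.Nonempty) {y : Euc n}
    (h0 : 0 < infDist y S) (h : infDist y S < uniqRadius S) {c ε : ℝ} (hc0 : 0 < c) (hc : c < 1)
    (hε : 0 < ε) :
    ∃ v : Euc n, 0 < ‖v‖ ∧ ‖v‖ < ε ∧ infDist y S + c * ‖v‖ ≤ infDist (y + v) S := by
  set d := infDist y S with hd
  set u : Euc n := d⁻¹ • (y - nearestPt S y) with hu
  have hyd : ‖y - nearestPt S y‖ = d := by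
    rw [← dist_eq_norm]; exact (nearestPt_spec hS hne y).2
  have hun : ‖u‖ = 1 := by
    rw [hu, norm_smul, hyd, norm_inv, Real.norm_of_nonneg h0.le, inv_mul_cancel₀ h0.ne']
  have hcont : ContinuousAt (fun s : ℝ => inner ℝ u (y - nearestPt S (y + s • u))) 0 := by
    have h1 : ContinuousAt (fun s : ℝ => nearestPt S (y + s • u)) 0 := by
      refine ContinuousAt.comp (g := nearestPt S) (f := fun s : ℝ => y + s • u) ?_ (by fun_prop)
      simpa using continuousAt_nearestPt hS hne h
    fun_prop
  have hval : inner ℝ u (y - nearestPt S (y + (0 : ℝ) • u)) = d := by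
    rw [zero_smul, add_zero, hu, real_inner_smul_left, real_inner_self_eq_norm_sq, hyd]
    field_simp
  have hev : ∀ᶠ s in 𝓝 (0 : ℝ), c * d < inner ℝ u (y - nearestPt S (y + s • u)) := by
    refine hcont.eventually_const_lt ?_
    simp only [hval]
    nlinarith
  obtain ⟨δ, hδ, hball⟩ := Metric.eventually_nhds_iff.1 hev
  set s := min δ ε / 2 with hs
  have hm : 0 < min δ ε := lt_min hδ hε
  have hs0 : 0 < s := by positivity
  have hsδ : s < δ := by have := min_le_left δ ε; linarith
  have hsε : s < ε := by have := min_le_right δ ε; linarith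
  have hsn : ‖s • u‖ = s := by rw [norm_smul, hun, Real.norm_of_nonneg hs0.le, mul_one]
  refine ⟨s • u, hsn.symm ▸ hs0, hsn.symm ▸ hsε, ?_⟩
  rw [hsn]
  have hin := hball (y := s) (by simpa [abs_of_pos hs0] using hsδ)
  set b := nearestPt S (y + s • u) with hb
  have hb' := nearestPt_spec hS hne (y + s • u)
  rw [← hb] at hb'
  rw [← hb'.2, dist_eq_norm]
  have hyb : d ≤ ‖y - b‖ := by
    rw [← dist_eq_norm]; exact infDist_le_dist_of_mem hb'.1
  have hsq : ‖y + s • u - b‖ ^ 2 = ‖y - b‖ ^ 2 + 2 * s * inner ℝ u (y - b) + s ^ 2 := by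
    rw [show y + s • u - b = (y - b) + s • u by abel, norm_add_sq_real, hsn,
      real_inner_smul_right, real_inner_comm]
    ring
  refine le_of_sq_le_sq ?_ (norm_nonneg _)
  rw [hsq]
  have h1 : d ^ 2 ≤ ‖y - b‖ ^ 2 := by gcongr
  have h2 : (c * s) ^ 2 ≤ s ^ 2 := by
    gcongr
    nlinarith
  nlinarith [mul_lt_mul_of_pos_left hin hs0]

/-- Prolonging a minimizing segment does not change the nearest point, up to distance
`uniqRadius S`. -/
theorem infDist_normal_ray (hS : IsCompact S) (hne : S.Nonempty) {x u : Euc n}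
    (h0 : 0 < infDist x S) (hu : x - nearestPt S x = infDist x S • u) {T : ℝ}
    (hxT : infDist x S ≤ T) (hT : T < uniqRadius S) :
    infDist (nearestPt S x + T • u) S = T := by
  set d := infDist x S with hd
  set a := nearestPt S x with ha
  have hspec := nearestPt_spec hS hne x
  rw [← ha] at hspec
  have hxa : ‖x - a‖ = d := by rw [← dist_eq_norm]; exact hspec.2
  have hun : ‖u‖ = 1 := by
    rw [hu, norm_smul, Real.norm_of_nonneg h0.le] at hxa
    exact mul_left_cancel₀ h0.ne' (hxa.trans (mul_one d).symm)
  set r := T - d with hr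
  have hr0 : 0 ≤ r := by linarith
  have hlip : ∀ y ∈ closedBall x r, infDist y S ≤ d + r := fun y hy => by
    have := infDist_le_infDist_add_dist (s := S) (x := y) (y := x)
    rw [mem_closedBall] at hy
    linarith
  have hne' : (closedBall x r).Nonempty := ⟨x, mem_closedBall_self hr0⟩
  have key : ∀ c : ℝ, 0 < c → c < 1 → ∃ y ∈ closedBall x r, d + c * r ≤ infDist y S := by
    intro c hc0 hc1
    obtain ⟨y, hy, hmax⟩ := (isCompact_closedBall x r).exists_isMaxOn hne'
      (f := fun y => infDist y S - c * dist y x)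
      ((continuous_infDist_pt S).sub (continuous_const.mul
        (continuous_id.dist continuous_const))).continuousOn
    have hyx : d ≤ infDist y S - c * dist y x := by
      simpa using hmax (mem_closedBall_self hr0)
    rw [mem_closedBall] at hy
    refine ⟨y, hy, ?_⟩
    rcases hy.lt_or_eq with hlt | heq
    · exfalso
      have hdy : 0 < infDist y S := by nlinarith [mul_nonneg hc0.le (dist_nonneg (x := y) (y := x))]
      have hyL : infDist y S < uniqRadius S := by
        linarith [hlip y (mem_closedBall.2 hy)]
      obtain ⟨v, hv0, hv, hinc⟩ := exists_infDist_add_ge hS hne hdy hyL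
        (c := (c + 1) / 2) (by linarith) (by linarith) (sub_pos.2 hlt)
      have hd1 : dist (y + v) x ≤ ‖v‖ + dist y x := by
        have := dist_triangle (y + v) y x
        simpa using this
      have hm := hmax (a := y + v) (mem_closedBall.2 (by linarith))
      simp only [mem_ofPred_eq] at hm
      nlinarith
    · rw [heq] at hyx
      linarith
  obtain ⟨y, hy, hmax⟩ := (isCompact_closedBall x r).exists_isMaxOn hne'
    (continuous_infDist_pt S).continuousOn
  have hge : d + r ≤ infDist y S := by
    refine le_of_forall_pos_lt_add fun ε hε => ?_
    set c := max (1 / 2) (1 - ε / (2 * (r + 1))) with hc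
    have hr1 : 0 < r + 1 := by linarith
    have hq : 0 < ε / (2 * (r + 1)) := by positivity
    obtain ⟨z, hz, hz'⟩ := key c (lt_of_lt_of_le (by norm_num) (le_max_left _ _))
      (max_lt (by norm_num) (by linarith))
    have hm : infDist z S ≤ infDist y S := hmax hz
    have h1 : (1 - ε / (2 * (r + 1))) * r ≤ c * r :=
      mul_le_mul_of_nonneg_right (le_max_right _ _) hr0
    have h2 : ε / (2 * (r + 1)) * r ≤ ε / 2 := by
      rw [div_mul_eq_mul_div, div_le_div_iff₀ (by positivity) (by norm_num)]
      nlinarith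
    linarith
  have hya : d + r ≤ ‖y - a‖ := by
    rw [← dist_eq_norm]; exact hge.trans (infDist_le_dist_of_mem hspec.1)
  have hyx : ‖y - x‖ ≤ r := by rw [← dist_eq_norm]; exact mem_closedBall.1 hy
  have hsum : ‖y - a‖ ^ 2 = ‖y - x‖ ^ 2 + 2 * d * inner ℝ (y - x) u + d ^ 2 := by
    rw [show y - a = (y - x) + (x - a) by abel, norm_add_sq_real, hxa, hu, real_inner_smul_right]
    ring
  have hinn : r ≤ inner ℝ (y - x) u := by
    have h1 : (d + r) ^ 2 ≤ ‖y - a‖ ^ 2 := by gcongr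
    have h2 : ‖y - x‖ ^ 2 ≤ r ^ 2 := by gcongr
    by_contra! hlt
    nlinarith [mul_lt_mul_of_pos_left hlt h0]
  have hzero : ‖y - x - r • u‖ ^ 2 ≤ 0 := by
    rw [norm_sub_sq_real, real_inner_smul_right, norm_smul, hun, Real.norm_of_nonneg hr0]
    have h2 : ‖y - x‖ ^ 2 ≤ r ^ 2 := by gcongr
    nlinarith [mul_le_mul_of_nonneg_left hinn hr0]
  have hyeq : y - x - r • u = 0 := by
    rw [← norm_eq_zero]; exact pow_eq_zero_iff two_ne_zero |>.1 (le_antisymm hzero (sq_nonneg _))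
  have hyT : a + T • u = y := by
    rw [show T = d + r by rw [hr]; ring, add_smul, ← hu]
    rw [← sub_eq_zero.1 hyeq]
    abel
  rw [hyT]
  linarith [hlip y hy, hge]

/-- A one-sided quadratic contact estimate at a nearest point. -/
theorem inner_sub_le_of_normal_ray (hS : IsCompact S) (hne : S.Nonempty) {x u b : Euc n}
    (h0 : 0 < infDist x S) (hu : x - nearestPt S x = infDist x S • u) {T : ℝ}
    (hxT : infDist x S ≤ T) (hT : T < uniqRadius S) (hb : b ∈ S) :
    2 * T * inner ℝ (b - nearestPt S x) u ≤ ‖b - nearestPt S x‖ ^ 2 := by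
  have hray := infDist_normal_ray hS hne h0 hu hxT hT
  set a := nearestPt S x with ha
  have hun : ‖u‖ = 1 := by
    have hxa : ‖x - a‖ = infDist x S := by
      rw [← dist_eq_norm]; exact (nearestPt_spec hS hne x).2
    rw [hu, norm_smul, Real.norm_of_nonneg h0.le] at hxa
    exact mul_left_cancel₀ h0.ne' (hxa.trans (mul_one _).symm)
  have hT0 : 0 < T := h0.trans_le hxT
  have h1 : T ≤ ‖T • u - (b - a)‖ := by
    have := infDist_le_dist_of_mem (x := a + T • u) hb
    rw [hray, dist_eq_norm, show a + T • u - b = T • u - (b - a) by abel] at this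
    exact this
  have h2 : T ^ 2 ≤ ‖T • u - (b - a)‖ ^ 2 := by gcongr
  rw [norm_sub_sq_real, norm_smul, hun, Real.norm_of_nonneg hT0.le, real_inner_smul_left,
    real_inner_comm] at h2
  linarith

end Projection

section Implicit

variable {E : Type*} [NormedAddCommGroup E] [NormedSpace ℝ E]

theorem eventually_pos_add_smul {f : E → ℝ} {f' : E →L[ℝ] ℝ} {a w : E} (hf : HasFDerivAt f f' a)
    (ha : f a = 0) (hw : 0 < f' w) : ∀ᶠ t in 𝓝[>] (0 : ℝ), 0 < f (a + t • w) := by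
  have hline := hf.hasLineDerivAt w
  have hslope := hasDerivAt_iff_tendsto_slope_zero.1 hline
  have hpos := (hslope.mono_left (nhdsGT_le_nhdsNE (0 : ℝ))).eventually_const_lt hw
  filter_upwards [hpos, self_mem_nhdsWithin] with t ht ht0
  simp only [zero_add, zero_smul, add_zero, ha, sub_zero, smul_eq_mul] at ht
  exact pos_of_mul_pos_right ht (inv_pos.2 ht0).le

/-- Differentiability of a continuous solution `(π, d)` of the system
`π z - d z • N (π z) = z`, `f (π z) = 0`. -/
theorem exists_hasFDerivAt_of_implicit [FiniteDimensional ℝ E] {f : E → ℝ} {N π : E → E}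
    {d : E → ℝ} {f' : E →L[ℝ] ℝ} {N' : E →L[ℝ] E} {z₀ : E}
    (hf : HasStrictFDerivAt f f' (π z₀)) (hN : HasStrictFDerivAt N N' (π z₀))
    (hπ : ContinuousAt π z₀) (hd : ContinuousAt d z₀)
    (hz : ∀ᶠ z in 𝓝 z₀, π z - d z • N (π z) = z) (hfπ : ∀ᶠ z in 𝓝 z₀, f (π z) = 0)
    (hinj : ∀ (w : E) (s : ℝ), w - d z₀ • N' w - s • N (π z₀) = 0 → f' w = 0 → w = 0 ∧ s = 0) :
    ∃ (P : E →L[ℝ] E) (s : E →L[ℝ] ℝ), HasFDerivAt π P z₀ ∧ HasFDerivAt d s z₀ ∧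
      ∀ v, f' (P v) = 0 ∧ P v - d z₀ • N' (P v) - s v • N (π z₀) = v := by
  have : CompleteSpace E := FiniteDimensional.complete ℝ E
  set Θ : E × ℝ → E × ℝ := fun p => (p.1 - p.2 • N p.1, f p.1) with hΘ
  set p₀ : E × ℝ := (π z₀, d z₀) with hp₀
  have h1 : HasStrictFDerivAt (fun p : E × ℝ => N p.1) (N' ∘L ContinuousLinearMap.fst ℝ E ℝ) p₀ :=
    HasStrictFDerivAt.comp p₀ (f := Prod.fst) hN hasStrictFDerivAt_fst
  have h2 : HasStrictFDerivAt (fun p : E × ℝ => f p.1) (f' ∘L ContinuousLinearMap.fst ℝ E ℝ) p₀ :=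
    HasStrictFDerivAt.comp p₀ (f := Prod.fst) hf hasStrictFDerivAt_fst
  have h3 := (hasStrictFDerivAt_fst (𝕜 := ℝ) (p := p₀)).sub
    ((hasStrictFDerivAt_snd (𝕜 := ℝ) (p := p₀)).smul h1)
  have hstrict := h3.prodMk h2
  set D := ((ContinuousLinearMap.fst ℝ E ℝ -
    (p₀.2 • (N' ∘L ContinuousLinearMap.fst ℝ E ℝ) +
      (ContinuousLinearMap.snd ℝ E ℝ).smulRight (N p₀.1))).prod
      (f' ∘L ContinuousLinearMap.fst ℝ E ℝ)) with hD
  have hDapply : ∀ w s, D (w, s) = (w - d z₀ • N' w - s • N (π z₀), f' w) := by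
    intro w s
    simp [hD, hp₀, sub_sub]
  have hDinj : Function.Injective (D : E × ℝ →ₗ[ℝ] E × ℝ) := by
    rw [← LinearMap.ker_eq_bot, LinearMap.ker_eq_bot']
    rintro ⟨w, s⟩ h
    have h' : D (w, s) = 0 := h
    rw [hDapply, Prod.mk_eq_zero] at h'
    obtain ⟨hw, hs⟩ := hinj w s h'.1 h'.2
    simp [hw, hs]
  set e : (E × ℝ) ≃L[ℝ] (E × ℝ) :=
    (LinearEquiv.ofInjectiveEndo (D : E × ℝ →ₗ[ℝ] E × ℝ) hDinj).toContinuousLinearEquiv with he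
  have heD : (e : E × ℝ →L[ℝ] E × ℝ) = D := by
    ext p <;> rfl
  have hΘe : HasStrictFDerivAt Θ (e : E × ℝ →L[ℝ] E × ℝ) p₀ := by
    rw [heD]; exact hstrict
  set ψ := hΘe.localInverse with hψ
  have hg : ContinuousAt (fun z => (π z, d z)) z₀ := hπ.prodMk hd
  have hgψ : (fun z => (π z, d z)) =ᶠ[𝓝 z₀] fun z => ψ (z, 0) := by
    filter_upwards [hg.eventually hΘe.eventually_left_inverse, hz, hfπ] with z hzψ hz1 hz2
    rw [← hzψ]
    simp only [hΘ, hz1, hz2, hψ]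
  have hΘ₀ : Θ p₀ = (z₀, 0) := by
    simp only [hΘ, hp₀, hz.self_of_nhds, hfπ.self_of_nhds]
  have hψ' : HasFDerivAt ψ (e.symm : E × ℝ →L[ℝ] E × ℝ) (z₀, 0) := by
    rw [← hΘ₀]; exact hΘe.to_localInverse.hasFDerivAt
  have hG : HasFDerivAt (fun z => (π z, d z))
      ((e.symm : E × ℝ →L[ℝ] E × ℝ) ∘L ContinuousLinearMap.inl ℝ E ℝ) z₀ :=
    (HasFDerivAt.comp z₀ (f := fun z : E => (z, (0 : ℝ))) hψ'
      (hasFDerivAt_prodMk_left z₀ (0 : ℝ))).congr_of_eventuallyEq hgψ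
  refine ⟨_, _, hG.fst, hG.snd, fun v => ?_⟩
  have hv : D (e.symm (v, 0)) = (v, 0) := by
    rw [← heD]; exact e.apply_symm_apply _
  rw [← Prod.mk.eta (p := e.symm (v, 0)), hDapply, Prod.mk.injEq] at hv
  exact ⟨hv.2, hv.1⟩

end Implicit

section NormalDirection

variable {E : Type*} [NormedAddCommGroup E] [InnerProductSpace ℝ E] [CompleteSpace E]

/-- If `f ≤ 0` on a ball having the zero `a` of `f` on its boundary, then the gradient of `f` at
`a` points away from the center. -/
theorem smul_sub_eq_of_nonpos_on_ball {f : E → ℝ} {g a x : E} (hf : HasGradientAt f g a)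
    (ha : f a = 0) (hball : ∀ᶠ y in 𝓝 a, y ∈ ball x ‖x - a‖ → f y ≤ 0) :
    ‖g‖ • (x - a) = -(‖x - a‖ • g) := by
  set p := x - a with hp
  have hexp : ‖‖g‖ • p + ‖p‖ • g‖ ^ 2 = 2 * ‖g‖ * ‖p‖ * (inner ℝ g p + ‖g‖ * ‖p‖) := by
    rw [norm_add_sq_real, norm_smul, norm_smul, norm_norm, norm_norm, real_inner_smul_left,
      real_inner_smul_right, real_inner_comm]
    ring
  rw [eq_neg_iff_add_eq_zero, ← norm_eq_zero, ← sq_eq_zero_iff, hexp]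
  by_contra hne
  have hg0 : 0 < ‖g‖ := (norm_nonneg g).lt_of_ne' fun h => hne (by rw [h]; ring)
  have hp0 : 0 < ‖p‖ := (norm_nonneg p).lt_of_ne' fun h => hne (by rw [h]; ring)
  have hcs : 0 < inner ℝ g p + ‖g‖ * ‖p‖ := by
    refine lt_of_le_of_ne ?_ fun h => hne (by rw [← h]; ring)
    linarith [neg_le_of_abs_le (abs_real_inner_le_norm g p)]
  set w := ‖p‖ • g + ‖g‖ • p with hw
  have hgw : 0 < inner ℝ g w := by
    rw [hw, inner_add_right, real_inner_smul_right, real_inner_smul_right,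
      real_inner_self_eq_norm_sq]
    nlinarith [mul_pos hg0 hcs]
  have hwp : 0 < inner ℝ p w := by
    rw [hw, inner_add_right, real_inner_smul_right, real_inner_smul_right,
      real_inner_self_eq_norm_sq, real_inner_comm]
    nlinarith [mul_pos hp0 hcs]
  have hpos := eventually_pos_add_smul (w := w) hf.hasFDerivAt ha (by simpa using hgw)
  have hmap : Tendsto (fun t : ℝ => a + t • w) (𝓝[>] 0) (𝓝 a) := by
    have : Continuous fun t : ℝ => a + t • w := by fun_prop
    simpa using (this.tendsto 0).mono_left nhdsWithin_le_nhds
  have hsmall : ∀ᶠ t in 𝓝[>] (0 : ℝ), t * ‖w‖ ^ 2 < 2 * inner ℝ p w := by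
    have : Continuous fun t : ℝ => t * ‖w‖ ^ 2 := by fun_prop
    refine (this.tendsto 0 |>.mono_left nhdsWithin_le_nhds).eventually_lt_const ?_
    simpa using hwp
  obtain ⟨t, ht1, ht2, ht3, ht0⟩ :=
    (hpos.and ((hmap.eventually hball).and (hsmall.and self_mem_nhdsWithin))).exists
  have ht0' : 0 < t := ht0
  refine absurd (ht2 ?_) (not_le.2 ht1)
  rw [mem_ball, dist_eq_norm, show a + t • w - x = -(p - t • w) by rw [hp]; abel, norm_neg]
  refine lt_of_pow_lt_pow_left₀ 2 (norm_nonneg _) ?_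
  rw [norm_sub_sq_real, real_inner_smul_right, norm_smul, Real.norm_of_nonneg ht0'.le]
  nlinarith [mul_lt_mul_of_pos_left ht3 ht0']

end NormalDirection

section Domain

variable {n : ℕ} {U : Set (Euc n)}

open Classical in
/-- The distance to `frontier U`, counted positively in `U` and negatively outside. -/
def innerDist (U : Set (Euc n)) (x : Euc n) : ℝ :=
  if x ∈ U then infDist x (frontier U) else -infDist x (frontier U)

theorem innerDist_of_mem {x : Euc n} (hx : x ∈ U) : innerDist U x = infDist x (frontier U) :=
  if_pos hx

theorem innerDist_of_notMem {x : Euc n} (hx : x ∉ U) :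
    innerDist U x = -infDist x (frontier U) :=
  if_neg hx

theorem abs_innerDist (x : Euc n) : |innerDist U x| = infDist x (frontier U) := by
  by_cases hx : x ∈ U
  · rw [innerDist_of_mem hx, abs_of_nonneg infDist_nonneg]
  · rw [innerDist_of_notMem hx, abs_neg, abs_of_nonneg infDist_nonneg]

theorem innerDist_of_mem_frontier {a : Euc n} (ha : a ∈ frontier U) : innerDist U a = 0 := by
  rw [← abs_eq_zero, abs_innerDist, infDist_zero_of_mem ha]

theorem innerDist_eventuallyEq (hU : IsOpen U) {x : Euc n} (hx : x ∈ U) :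
    innerDist U =ᶠ[𝓝 x] fun y => infDist y (frontier U) := by
  filter_upwards [hU.mem_nhds hx] with y hy using innerDist_of_mem hy

theorem continuousAt_innerDist_of_mem (hU : IsOpen U) {x : Euc n} (hx : x ∈ U) :
    ContinuousAt (innerDist U) x :=
  (continuous_infDist_pt _).continuousAt.congr (innerDist_eventuallyEq hU hx).symm

theorem continuousAt_innerDist_of_mem_frontier {a : Euc n} (ha : a ∈ frontier U) :
    ContinuousAt (innerDist U) a := by
  rw [ContinuousAt, innerDist_of_mem_frontier ha, tendsto_zero_iff_abs_tendsto_zero]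
  have h := (continuous_infDist_pt (frontier U)).tendsto a
  rw [infDist_zero_of_mem ha] at h
  exact h.congr fun z => (abs_innerDist z).symm

theorem notMem_frontier_of_mem (hU : IsOpen U) {x : Euc n} (hx : x ∈ U) : x ∉ frontier U :=
  fun h => disjoint_left.1 (disjoint_frontier_iff_isOpen.2 hU) h hx

theorem infDist_frontier_pos (hU : IsOpen U) (hfne : (frontier U).Nonempty) {x : Euc n}
    (hx : x ∈ U) : 0 < infDist x (frontier U) :=
  (isClosed_frontier.notMem_iff_infDist_pos hfne).1 (notMem_frontier_of_mem hU hx)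

theorem subset_union_compl_closure (hU : IsOpen U) {x : Euc n} {r : ℝ}
    (hr : r ≤ infDist x (frontier U)) : ball x r ⊆ U ∪ (closure U)ᶜ := by
  intro y hy
  by_contra hn
  simp only [mem_union, mem_compl_iff, not_or, not_not] at hn
  have hyf : y ∈ frontier U := by rw [hU.frontier_eq]; exact ⟨hn.2, hn.1⟩
  have := infDist_le_dist_of_mem (x := x) hyf
  rw [mem_ball, dist_comm] at hy
  linarith

theorem ball_subset_of_le_infDist_frontier (hU : IsOpen U) {x : Euc n} (hx : x ∈ U) {r : ℝ}
    (hr : r ≤ infDist x (frontier U)) : ball x r ⊆ U := by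
  rcases (ball x r).eq_empty_or_nonempty with he | hne
  · rw [he]; exact empty_subset _
  · exact (convex_ball x r).isPreconnected.subset_left_of_subset_union hU
      isClosed_closure.isOpen_compl (disjoint_compl_right_iff_subset.2 subset_closure)
      (subset_union_compl_closure hU hr) ⟨x, mem_ball_self (nonempty_ball.1 hne), hx⟩

theorem ball_subset_compl_closure_of_le_infDist_frontier (hU : IsOpen U) {x : Euc n}
    (hx : x ∉ closure U) {r : ℝ} (hr : r ≤ infDist x (frontier U)) : ball x r ⊆ (closure U)ᶜ := by
  rcases (ball x r).eq_empty_or_nonempty with he | hne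
  · rw [he]; exact empty_subset _
  · exact (convex_ball x r).isPreconnected.subset_right_of_subset_union hU
      isClosed_closure.isOpen_compl (disjoint_compl_right_iff_subset.2 subset_closure)
      (subset_union_compl_closure hU hr) ⟨x, mem_ball_self (nonempty_ball.1 hne), hx⟩

namespace CkDomain

variable (B : CkDomain n 3 U) {a : Euc n}

theorem mem_of_neg {y : Euc n} (hy : y ∈ B.O) (hfy : B.f y < 0) : y ∈ U := by
  by_contra hyU
  by_cases hyc : y ∈ closure U
  · rw [closure_eq_self_union_frontier] at hyc
    rcases hyc with h | h
    · exact hyU h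
    · exact hfy.ne (B.zero y h)
  · exact (B.pos y ⟨hy, hyc⟩).not_gt hfy

theorem contDiffAt_f (ha : a ∈ frontier U) : ContDiffAt ℝ 3 B.f a :=
  B.smooth.contDiffAt (B.opO.mem_nhds (B.front ha))

theorem hasGradientAt_f (ha : a ∈ frontier U) : HasGradientAt B.f (gradient B.f a) a :=
  ((B.contDiffAt_f ha).differentiableAt (by norm_num)).hasGradientAt

theorem contDiffAt_gradient (ha : a ∈ frontier U) : ContDiffAt ℝ 2 (gradient B.f) a := by
  have h : ContDiffAt ℝ 2 (fderiv ℝ B.f) a :=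
    (B.contDiffAt_f ha).fderiv_right (by norm_num)
  exact (InnerProductSpace.toDual ℝ (Euc n)).symm.toContinuousLinearEquiv.contDiff.contDiffAt.comp
    a h

theorem contDiffAt_nu (ha : a ∈ frontier U) : ContDiffAt ℝ 2 B.nu a := by
  have hg := B.contDiffAt_gradient ha
  exact ((hg.norm ℝ (B.grad_ne a ha)).inv (norm_ne_zero_iff.2 (B.grad_ne a ha))).smul hg

theorem hasStrictFDerivAt_nu (ha : a ∈ frontier U) :
    HasStrictFDerivAt B.nu (fderiv ℝ B.nu a) a :=
  (B.contDiffAt_nu ha).hasStrictFDerivAt (by norm_num)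

theorem norm_nu {y : Euc n} (hy : gradient B.f y ≠ 0) : ‖B.nu y‖ = 1 := by
  rw [nu, norm_smul, norm_inv, norm_norm, inv_mul_cancel₀ (norm_ne_zero_iff.2 hy)]

theorem norm_nu_of_mem (ha : a ∈ frontier U) : ‖B.nu a‖ = 1 :=
  B.norm_nu (B.grad_ne a ha)

theorem inner_nu_self (ha : a ∈ frontier U) : inner ℝ (B.nu a) (B.nu a) = 1 := by
  rw [real_inner_self_eq_norm_sq, B.norm_nu_of_mem ha, one_pow]

theorem inner_nu_fderiv_nu (ha : a ∈ frontier U) (w : Euc n) :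
    inner ℝ (B.nu a) (fderiv ℝ B.nu a w) = 0 := by
  have hd := (B.hasStrictFDerivAt_nu ha).hasFDerivAt
  have h1 := hd.norm_sq
  have h2 : (fun y => ‖B.nu y‖ ^ 2) =ᶠ[𝓝 a] fun _ => 1 := by
    filter_upwards [(B.contDiffAt_gradient ha).continuousAt.eventually_ne (B.grad_ne a ha)]
      with y hy
    rw [B.norm_nu hy, one_pow]
  have h3 := h1.unique ((hasFDerivAt_const (1 : ℝ) a).congr_of_eventuallyEq h2)
  have h4 := DFunLike.congr_fun h3 w
  simpa using h4

theorem smul_nu (ha : a ∈ frontier U) : ‖gradient B.f a‖ • B.nu a = gradient B.f a := by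
  rw [nu, smul_smul, mul_inv_cancel₀ (norm_ne_zero_iff.2 (B.grad_ne a ha)), one_smul]

theorem fderiv_f_apply (ha : a ∈ frontier U) (w : Euc n) :
    fderiv ℝ B.f a w = ‖gradient B.f a‖ * inner ℝ (B.nu a) w := by
  rw [← real_inner_smul_left, B.smul_nu ha, (B.hasGradientAt_f ha).hasFDerivAt.fderiv]
  simp

theorem fderiv_f_eq_zero_iff (ha : a ∈ frontier U) (w : Euc n) :
    fderiv ℝ B.f a w = 0 ↔ inner ℝ (B.nu a) w = 0 := by
  rw [B.fderiv_f_apply ha, mul_eq_zero, or_iff_right (norm_ne_zero_iff.2 (B.grad_ne a ha))]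

/-- Every point is reached from its projection by following the unit normal. -/
theorem nearestPt_sub_smul (hU : IsOpen U) (hfne : (frontier U).Nonempty)
    (hfc : IsCompact (frontier U)) (x : Euc n) :
    nearestPt (frontier U) x - innerDist U x • B.nu (nearestPt (frontier U) x) = x := by
  obtain ⟨ha, hd⟩ := nearestPt_spec hfc hfne x
  set a := nearestPt (frontier U) x
  rw [dist_eq_norm] at hd
  have hg0 : ‖gradient B.f a‖ ≠ 0 := norm_ne_zero_iff.2 (B.grad_ne a ha)
  have hO : ∀ᶠ y in 𝓝 a, y ∈ B.O := B.opO.mem_nhds (B.front ha)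
  have hgrad := B.hasGradientAt_f ha
  have hnormal : ∀ c : ℝ, ‖gradient B.f a‖ • (x - a) = -(c • gradient B.f a) →
      a - c • B.nu a = x := by
    intro c hc
    have h1 : x - a = -(c • B.nu a) := by
      apply smul_right_injective _ hg0
      simp only
      rw [hc, smul_neg, smul_comm, B.smul_nu ha]
    rw [sub_eq_iff_eq_add, eq_comm, ← sub_eq_zero, ← neg_neg (c • B.nu a), ← h1]
    abel
  apply hnormal
  by_cases hxc : x ∈ closure U
  · rw [closure_eq_self_union_frontier] at hxc
    by_cases hxU : x ∈ U
    · rw [innerDist_of_mem hxU, ← hd]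
      refine smul_sub_eq_of_nonpos_on_ball hgrad (B.zero a ha) ?_
      filter_upwards [hO] with y hy hyb
      exact (B.neg y ⟨hy, ball_subset_of_le_infDist_frontier hU hxU hd.le hyb⟩).le
    · have hx0 := infDist_zero_of_mem (hxc.resolve_left hxU)
      rw [hx0, norm_eq_zero] at hd
      rw [innerDist_of_notMem hxU, hx0, hd]
      simp
  · rw [innerDist_of_notMem fun h => hxc (subset_closure h), ← hd]
    have hneg : HasGradientAt (fun y => -B.f y) (-gradient B.f a) a := by
      have := hgrad.hasFDerivAt.neg
      rw [hasGradientAt_iff_hasFDerivAt, map_neg]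
      exact this
    have h := smul_sub_eq_of_nonpos_on_ball hneg (x := x) (by simp [B.zero a ha]) (by
      filter_upwards [hO] with y hy hyb
      have := B.pos y ⟨hy, ball_subset_compl_closure_of_le_infDist_frontier hU hxc hd.le hyb⟩
      linarith)
    rw [norm_neg] at h
    rw [h]
    simp

end CkDomain

end Domain

section Corona

namespace CkDomain

variable {n : ℕ} {U : Set (Euc n)} (B : CkDomain n 3 U)

theorem exists_hasFDerivAt_nearestPt (hU : IsOpen U) (hfne : (frontier U).Nonempty)
    (hfc : IsCompact (frontier U)) {z a : Euc n} (hza : nearestPt (frontier U) z = a)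
    (hz : infDist z (frontier U) < uniqRadius (frontier U))
    (hd : ContinuousAt (innerDist U) z)
    (hinj : ∀ w, inner ℝ (B.nu a) w = 0 → innerDist U z • fderiv ℝ B.nu a w = w → w = 0) :
    ∃ P : Euc n →L[ℝ] Euc n, HasFDerivAt (nearestPt (frontier U)) P z ∧
      HasFDerivAt (innerDist U) (-innerSL ℝ (B.nu a)) z ∧
      HasFDerivAt B.nuGeo (fderiv ℝ B.nu a ∘L P) z ∧
      ∀ v, inner ℝ (B.nu a) (P v) = 0 ∧
        P v = v - inner ℝ (B.nu a) v • B.nu a + innerDist U z • fderiv ℝ B.nu a (P v) := by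
  have ha : a ∈ frontier U := hza ▸ (nearestPt_spec hfc hfne z).1
  have hN := B.hasStrictFDerivAt_nu ha
  have hf : HasStrictFDerivAt B.f (fderiv ℝ B.f a) a :=
    (B.contDiffAt_f ha).hasStrictFDerivAt (by norm_num)
  obtain ⟨P, s, hP, hs, hPs⟩ := exists_hasFDerivAt_of_implicit (π := nearestPt (frontier U))
    (d := innerDist U) (hza.symm ▸ hf) (hza.symm ▸ hN) (continuousAt_nearestPt hfc hfne hz) hd
    (Eventually.of_forall (B.nearestPt_sub_smul hU hfne hfc))
    (Eventually.of_forall fun y => B.zero _ (nearestPt_spec hfc hfne y).1) (by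
      intro w s hw hfw
      rw [hza] at hw hfw
      rw [B.fderiv_f_eq_zero_iff ha] at hfw
      have hs : s = 0 := by
        have := congrArg (inner ℝ (B.nu a)) hw
        simpa [inner_sub_right, real_inner_smul_right, hfw, B.inner_nu_fderiv_nu ha,
          B.norm_nu_of_mem ha] using this
      rw [hs, zero_smul, sub_zero, sub_eq_zero] at hw
      exact ⟨hinj w hfw hw.symm, hs⟩)
  rw [hza] at hPs
  simp only [B.fderiv_f_eq_zero_iff ha] at hPs
  have hsv : ∀ v, s v = -inner ℝ (B.nu a) v := fun v => by
    obtain ⟨h1, h2⟩ := hPs v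
    have h3 := congrArg (inner ℝ (B.nu a)) h2
    simp only [inner_sub_right, real_inner_smul_right, h1, B.inner_nu_fderiv_nu ha,
      B.inner_nu_self ha] at h3
    linarith
  have hs' : s = -innerSL ℝ (B.nu a) := by
    ext v
    simp [hsv]
  refine ⟨P, hP, hs' ▸ hs, HasFDerivAt.comp z (g := B.nu) (hza.symm ▸ hN.hasFDerivAt) hP,
    fun v => ⟨(hPs v).1, ?_⟩⟩
  have h2 := (hPs v).2
  rw [hsv] at h2
  nth_rewrite 2 [← h2]
  rw [neg_smul]
  abel

/-- The curvature tensor `dν_a`, extended by zero in the normal direction. -/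
theorem hasFDerivAt_nuGeo_of_mem_frontier (hU : IsOpen U) (hfne : (frontier U).Nonempty)
    (hfc : IsCompact (frontier U)) (hL : 0 < uniqRadius (frontier U)) {a : Euc n}
    (ha : a ∈ frontier U) :
    HasFDerivAt (nearestPt (frontier U))
      (ContinuousLinearMap.id ℝ (Euc n) - (innerSL ℝ (B.nu a)).smulRight (B.nu a)) a ∧
    HasFDerivAt B.nuGeo (fderiv ℝ B.nu a ∘L
      (ContinuousLinearMap.id ℝ (Euc n) - (innerSL ℝ (B.nu a)).smulRight (B.nu a))) a := by
  have h0 := innerDist_of_mem_frontier ha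
  obtain ⟨P, hP, -, hν, hPv⟩ := B.exists_hasFDerivAt_nearestPt hU hfne hfc
    (nearestPt_of_mem hfc hfne ha) (by rwa [infDist_zero_of_mem ha])
    (continuousAt_innerDist_of_mem_frontier ha) (fun w _ hw => by
      rw [h0, zero_smul] at hw
      exact hw.symm)
  have hPe : P = ContinuousLinearMap.id ℝ (Euc n) - (innerSL ℝ (B.nu a)).smulRight (B.nu a) := by
    ext1 v
    rw [(hPv v).2, h0]
    simp
  rw [← hPe]
  exact ⟨hP, hν⟩

theorem fderiv_nuGeo_apply (hU : IsOpen U) (hfne : (frontier U).Nonempty)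
    (hfc : IsCompact (frontier U)) (hL : 0 < uniqRadius (frontier U)) {a : Euc n}
    (ha : a ∈ frontier U) (v : Euc n) :
    fderiv ℝ B.nuGeo a v = fderiv ℝ B.nu a (v - inner ℝ (B.nu a) v • B.nu a) := by
  rw [(B.hasFDerivAt_nuGeo_of_mem_frontier hU hfne hfc hL ha).2.fderiv]
  simp

theorem sub_nearestPt_eq (hU : IsOpen U) (hfne : (frontier U).Nonempty)
    (hfc : IsCompact (frontier U)) {x : Euc n} (hx : x ∈ U) :
    x - nearestPt (frontier U) x =
      infDist x (frontier U) • -B.nu (nearestPt (frontier U) x) := by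
  have h := B.nearestPt_sub_smul hU hfne hfc x
  rw [innerDist_of_mem hx] at h
  nth_rewrite 1 [← h]
  rw [smul_neg]
  abel

/-- The normal field is one-sidedly monotone along the hypersurface. -/
theorem mul_inner_nu_sub_le (hU : IsOpen U) (hfne : (frontier U).Nonempty)
    (hfc : IsCompact (frontier U)) {x z : Euc n} (hx : x ∈ U) (hz : z ∈ U) {T : ℝ}
    (hxT : infDist x (frontier U) ≤ T) (hzT : infDist z (frontier U) ≤ T)
    (hT : T < uniqRadius (frontier U)) :
    T * inner ℝ (nearestPt (frontier U) z - nearestPt (frontier U) x) (B.nuGeo z - B.nuGeo x) ≤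
      ‖nearestPt (frontier U) z - nearestPt (frontier U) x‖ ^ 2 := by
  have h1 := inner_sub_le_of_normal_ray hfc hfne (infDist_frontier_pos hU hfne hx)
    (B.sub_nearestPt_eq hU hfne hfc hx) hxT hT (nearestPt_spec hfc hfne z).1
  have h2 := inner_sub_le_of_normal_ray hfc hfne (infDist_frontier_pos hU hfne hz)
    (B.sub_nearestPt_eq hU hfne hfc hz) hzT hT (nearestPt_spec hfc hfne x).1
  rw [norm_sub_rev, ← neg_sub, inner_neg_neg] at h2
  rw [inner_neg_right] at h1
  rw [nuGeo, nuGeo, inner_sub_right]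
  linarith

/-- Upper bound of the curvature tensor in terms of the radius of uniqueness. -/
theorem mul_inner_fderiv_nu_le (hU : IsOpen U) (hfne : (frontier U).Nonempty)
    (hfc : IsCompact (frontier U)) {x a : Euc n} (hx : x ∈ U)
    (hxa : nearestPt (frontier U) x = a) {T : ℝ}
    (hxT : infDist x (frontier U) ≤ T) (hT : T < uniqRadius (frontier U)) {w : Euc n}
    (hw : inner ℝ (B.nu a) w = 0) :
    T * inner ℝ w (fderiv ℝ B.nu a w) ≤ ‖w‖ ^ 2 := by
  have ha : a ∈ frontier U := hxa ▸ (nearestPt_spec hfc hfne x).1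
  have hx0 := infDist_frontier_pos hU hfne hx
  have hνν := B.inner_nu_self ha
  obtain ⟨hP, hν⟩ := B.hasFDerivAt_nuGeo_of_mem_frontier hU hfne hfc
    (hx0.trans_le hxT |>.trans hT) ha
  set v := w - B.nu a with hv
  have hνv : inner ℝ (B.nu a) v = -1 := by rw [hv, inner_sub_right, hw, hνν]; ring
  have hPline := hasDerivAt_iff_tendsto_slope_zero.1 (hP.hasLineDerivAt v)
  have hνline := hasDerivAt_iff_tendsto_slope_zero.1 (hν.hasLineDerivAt v)
  have hvw : v - inner ℝ (B.nu a) v • B.nu a = w := by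
    rw [hνv, hv, neg_one_smul]
    abel
  have hPv : (ContinuousLinearMap.id ℝ (Euc n) - (innerSL ℝ (B.nu a)).smulRight (B.nu a)) v = w := by
    simpa using hvw
  rw [ContinuousLinearMap.comp_apply, hPv] at hνline
  rw [hPv] at hPline
  simp only [zero_add, zero_smul, add_zero] at hPline hνline
  rw [nearestPt_of_mem hfc hfne ha] at hPline
  have hlhs := ((hPline.inner hνline).const_mul T).mono_left (nhdsGT_le_nhdsNE (0 : ℝ))
  have hrhs := (hPline.norm.pow 2).mono_left (nhdsGT_le_nhdsNE (0 : ℝ))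
  have hmap : Tendsto (fun t : ℝ => a + t • v) (𝓝[>] 0) (𝓝 a) := by
    have : Continuous fun t : ℝ => a + t • v := by fun_prop
    simpa using (this.tendsto 0).mono_left nhdsWithin_le_nhds
  have hneg : ∀ᶠ t in 𝓝[>] (0 : ℝ), 0 < -B.f (a + t • v) := by
    refine eventually_pos_add_smul (f := fun y => -B.f y)
      ((B.contDiffAt_f ha).differentiableAt (by norm_num)).hasFDerivAt.neg
      (by simp [B.zero a ha]) ?_
    rw [neg_apply, B.fderiv_f_apply ha, hνv]
    simpa using B.grad_ne a ha
  have hO : ∀ᶠ t in 𝓝[>] (0 : ℝ), a + t • v ∈ B.O :=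
    hmap.eventually (B.opO.mem_nhds (B.front ha))
  have hsmall : ∀ᶠ t in 𝓝[>] (0 : ℝ), infDist (a + t • v) (frontier U) < T := by
    refine ((continuous_infDist_pt (frontier U)).continuousAt.tendsto.comp hmap).eventually_lt_const
      ?_
    rw [infDist_zero_of_mem ha]
    exact hx0.trans_le hxT
  refine le_of_tendsto_of_tendsto hlhs hrhs ?_
  filter_upwards [hneg, hO, hsmall, self_mem_nhdsWithin] with t h1 h2 h3 ht
  have hz : a + t • v ∈ U := B.mem_of_neg h2 (by linarith)
  have hmono := B.mul_inner_nu_sub_le hU hfne hfc hx hz hxT h3.le hT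
  have hνx : B.nuGeo x = B.nuGeo a := by
    rw [nuGeo, nuGeo, hxa, nearestPt_of_mem hfc hfne ha]
  rw [hxa, hνx] at hmono
  rw [real_inner_smul_left, real_inner_smul_right, norm_smul, mul_pow, Real.norm_eq_abs, sq_abs]
  have := mul_le_mul_of_nonneg_left hmono (sq_nonneg t⁻¹)
  linarith

theorem eq_zero_of_smul_fderiv_nu_eq (hU : IsOpen U) (hfne : (frontier U).Nonempty)
    (hfc : IsCompact (frontier U)) {x a : Euc n} (hx : x ∈ U)
    (hxa : nearestPt (frontier U) x = a)
    (hxL : infDist x (frontier U) < uniqRadius (frontier U)) {w : Euc n}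
    (hw : inner ℝ (B.nu a) w = 0) (hfix : infDist x (frontier U) • fderiv ℝ B.nu a w = w) :
    w = 0 := by
  obtain ⟨T, hxT, hT⟩ := exists_between hxL
  have hx0 := infDist_frontier_pos hU hfne hx
  have h1 := B.mul_inner_fderiv_nu_le hU hfne hfc hx hxa hxT.le hT hw
  have h2 : infDist x (frontier U) * inner ℝ w (fderiv ℝ B.nu a w) = ‖w‖ ^ 2 := by
    rw [← real_inner_smul_right, hfix, real_inner_self_eq_norm_sq]
  by_contra hne
  have hpos : 0 < ‖w‖ ^ 2 := by positivity
  have hin : 0 < inner ℝ w (fderiv ℝ B.nu a w) :=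
    pos_of_mul_pos_right (h2.symm ▸ hpos) hx0.le
  nlinarith

theorem exists_hasFDerivAt_nearestPt_of_mem (hU : IsOpen U) (hfne : (frontier U).Nonempty)
    (hfc : IsCompact (frontier U)) {x a : Euc n} (hx : x ∈ U)
    (hxa : nearestPt (frontier U) x = a)
    (hxL : infDist x (frontier U) < uniqRadius (frontier U)) :
    ∃ P : Euc n →L[ℝ] Euc n, HasFDerivAt (nearestPt (frontier U)) P x ∧
      HasFDerivAt (fun y => infDist y (frontier U)) (-innerSL ℝ (B.nu a)) x ∧
      HasFDerivAt B.nuGeo (fderiv ℝ B.nu a ∘L P) x ∧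
      ∀ v, inner ℝ (B.nu a) (P v) = 0 ∧ P v = v - inner ℝ (B.nu a) v • B.nu a +
        infDist x (frontier U) • fderiv ℝ B.nu a (P v) := by
  rw [← innerDist_of_mem hx]
  obtain ⟨P, hP, hd, hν, hPv⟩ := B.exists_hasFDerivAt_nearestPt hU hfne hfc hxa hxL
    (continuousAt_innerDist_of_mem hU hx) (fun w hw hfix =>
      B.eq_zero_of_smul_fderiv_nu_eq hU hfne hfc hx hxa hxL hw (innerDist_of_mem hx ▸ hfix))
  exact ⟨P, hP, hd.congr_of_eventuallyEq (innerDist_eventuallyEq hU hx).symm, hν, hPv⟩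

/-- The Hessian of the distance function is the opposite of the derivative of the geometric
extension of the normal field. -/
theorem norm_fderiv_fderiv_infDist (hU : IsOpen U) (hfne : (frontier U).Nonempty)
    (hfc : IsCompact (frontier U)) {x : Euc n} (hx : x ∈ U)
    (hxL : infDist x (frontier U) < uniqRadius (frontier U)) :
    ‖fderiv ℝ (fderiv ℝ (fun y : Euc n => infDist y (frontier U))) x‖ =
      ‖fderiv ℝ B.nuGeo x‖ := by
  set J : Euc n →L[ℝ] Euc n →L[ℝ] ℝ := innerSL ℝ with hJ
  have hgrad : fderiv ℝ (fun y : Euc n => infDist y (frontier U)) =ᶠ[𝓝 x]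
      fun z => -J (B.nuGeo z) := by
    filter_upwards [hU.mem_nhds hx,
      (continuous_infDist_pt (frontier U)).continuousAt.eventually_lt_const hxL] with z hz hzL
    obtain ⟨-, -, hd, -⟩ := B.exists_hasFDerivAt_nearestPt_of_mem hU hfne hfc hz rfl hzL
    exact hd.fderiv
  obtain ⟨P, -, -, hν, -⟩ := B.exists_hasFDerivAt_nearestPt_of_mem hU hfne hfc hx rfl hxL
  have h2 : HasFDerivAt (fun z => -J (B.nuGeo z)) (-(J ∘L fderiv ℝ B.nuGeo x)) x :=
    (J.hasFDerivAt.comp x hν.differentiableAt.hasFDerivAt).neg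
  rw [hgrad.fderiv_eq, h2.fderiv]
  exact (norm_neg (J ∘L fderiv ℝ B.nuGeo x)).trans
    (InnerProductSpace.toDualMap ℝ (Euc n)).norm_toContinuousLinearMap_comp

theorem isUnit_one_sub_smul_fderiv_nuGeo (hU : IsOpen U) (hfne : (frontier U).Nonempty)
    (hfc : IsCompact (frontier U)) {x a : Euc n} (hx : x ∈ U)
    (hxa : nearestPt (frontier U) x = a)
    (hxL : infDist x (frontier U) < uniqRadius (frontier U)) :
    IsUnit ((1 : Euc n →L[ℝ] Euc n) - infDist x (frontier U) • fderiv ℝ B.nuGeo a) := by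
  have ha : a ∈ frontier U := hxa ▸ (nearestPt_spec hfc hfne x).1
  have hL := (infDist_frontier_pos hU hfne hx).trans hxL
  set A := (1 : Euc n →L[ℝ] Euc n) - infDist x (frontier U) • fderiv ℝ B.nuGeo a with hA
  have hinj : Function.Injective (A : Euc n →ₗ[ℝ] Euc n) := by
    rw [← LinearMap.ker_eq_bot, LinearMap.ker_eq_bot']
    intro v hv
    have hv' : infDist x (frontier U) • fderiv ℝ B.nuGeo a v = v := by
      have : A v = 0 := hv
      simp only [hA, sub_apply, one_apply_eq_self,
        smul_apply, sub_eq_zero] at this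
      exact this.symm
    rw [B.fderiv_nuGeo_apply hU hfne hfc hL ha] at hv'
    have hνv : inner ℝ (B.nu a) v = 0 := by
      rw [← hv', real_inner_smul_right, B.inner_nu_fderiv_nu ha, mul_zero]
    rw [hνv, zero_smul, sub_zero] at hv'
    exact B.eq_zero_of_smul_fderiv_nu_eq hU hfne hfc hx hxa hxL hνv hv'
  rw [ContinuousLinearMap.isUnit_iff_bijective]
  exact ⟨hinj, LinearMap.injective_iff_surjective.1 hinj⟩

/-- The Riccati formula for the normal field at distance `h` from the hypersurface. -/
theorem fderiv_nuGeo_eq (hU : IsOpen U) (hfne : (frontier U).Nonempty)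
    (hfc : IsCompact (frontier U)) {x a : Euc n} (hx : x ∈ U)
    (hxa : nearestPt (frontier U) x = a)
    (hxL : infDist x (frontier U) < uniqRadius (frontier U)) :
    fderiv ℝ B.nuGeo x = fderiv ℝ B.nuGeo a *
      Ring.inverse ((1 : Euc n →L[ℝ] Euc n) - infDist x (frontier U) • fderiv ℝ B.nuGeo a) := by
  have ha : a ∈ frontier U := hxa ▸ (nearestPt_spec hfc hfne x).1
  have hL := (infDist_frontier_pos hU hfne hx).trans hxL
  have hA := B.fderiv_nuGeo_apply hU hfne hfc hL ha
  obtain ⟨P, -, -, hν, hPv⟩ := B.exists_hasFDerivAt_nearestPt_of_mem hU hfne hfc hx hxa hxL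
  have hunit := B.isUnit_one_sub_smul_fderiv_nuGeo hU hfne hfc hx hxa hxL
  have hmul : fderiv ℝ B.nuGeo x *
      ((1 : Euc n →L[ℝ] Euc n) - infDist x (frontier U) • fderiv ℝ B.nuGeo a) =
        fderiv ℝ B.nuGeo a := by
    ext1 v
    set w := v - inner ℝ (B.nu a) v • B.nu a with hw
    have hνw : inner ℝ (B.nu a) w = 0 := by
      rw [hw, inner_sub_right, real_inner_smul_right, B.inner_nu_self ha]
      ring
    set y := v - infDist x (frontier U) • fderiv ℝ B.nu a w with hy
    have hνy : inner ℝ (B.nu a) y = inner ℝ (B.nu a) v := by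
      rw [hy, inner_sub_right, real_inner_smul_right, B.inner_nu_fderiv_nu ha]
      ring
    have hPy : P y = w := by
      rw [← sub_eq_zero]
      refine B.eq_zero_of_smul_fderiv_nu_eq hU hfne hfc hx hxa hxL ?_ ?_
      · rw [inner_sub_right, (hPv y).1, hνw, sub_zero]
      · nth_rewrite 2 [(hPv y).2]
        rw [hνy, map_sub, smul_sub, hy, hw]
        abel
    rw [mul_apply_eq_comp, sub_apply,
      one_apply_eq_self, smul_apply, hA v, ← hw, ← hy, hν.fderiv,
      ContinuousLinearMap.comp_apply, hPy]
  rw [← hmul, mul_assoc, hmul, Ring.mul_inverse_cancel _ hunit, mul_one]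

theorem norm_smul_fderiv_nuGeo_le_one (hU : IsOpen U) (hfne : (frontier U).Nonempty)
    (hfc : IsCompact (frontier U)) {x : Euc n} (hx : x ∈ U)
    (hxL : infDist x (frontier U) < uniqRadius (frontier U) / 2) :
    ‖infDist x (frontier U) • fderiv ℝ B.nuGeo x‖ ≤ 1 := by
  have hx0 := infDist_frontier_pos hU hfne hx
  set a := nearestPt (frontier U) x with hxa
  have ha : a ∈ frontier U := (nearestPt_spec hfc hfne x).1
  obtain ⟨P, -, -, hν, hPv⟩ :=
    B.exists_hasFDerivAt_nearestPt_of_mem hU hfne hfc hx hxa.symm (by linarith)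
  set h := infDist x (frontier U) with hh
  refine ContinuousLinearMap.opNorm_le_bound _ zero_le_one fun v => ?_
  obtain ⟨hνw, hv⟩ := hPv v
  rw [smul_apply, hν.fderiv, ContinuousLinearMap.comp_apply, one_mul]
  set w := P v with hw
  have hcurv : 2 * h * inner ℝ w (fderiv ℝ B.nu a w) ≤ ‖w‖ ^ 2 :=
    B.mul_inner_fderiv_nu_le hU hfne hfc hx hxa.symm (by linarith) (by linarith) hνw
  have hv' : v = (w - h • fderiv ℝ B.nu a w) + inner ℝ (B.nu a) v • B.nu a := by
    generalize h • fderiv ℝ B.nu a w = q at hv ⊢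
    rw [hv]
    abel
  have horth : inner ℝ (w - h • fderiv ℝ B.nu a w) (inner ℝ (B.nu a) v • B.nu a) = 0 := by
    rw [real_inner_smul_right, real_inner_comm (B.nu a) (w - _), inner_sub_right, hνw,
      real_inner_smul_right, B.inner_nu_fderiv_nu ha]
    ring
  have hnorm : ‖v‖ ^ 2 = ‖w - h • fderiv ℝ B.nu a w‖ ^ 2 +
      ‖inner ℝ (B.nu a) v • B.nu a‖ ^ 2 := by
    nth_rewrite 1 [hv']
    rw [norm_add_sq_real, horth]
    ring
  rw [norm_sub_sq_real, real_inner_smul_right] at hnorm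
  refine le_of_sq_le_sq ?_ (norm_nonneg _)
  nlinarith [sq_nonneg ‖inner ℝ (B.nu a) v • B.nu a‖]

theorem norm_fderiv_reflAcross_le (B : CkDomain n 3 U) (hU : IsOpen U)
    (hfne : (frontier U).Nonempty) (hfc : IsCompact (frontier U)) {x : Euc n} (hx : x ∈ U)
    (hxL : infDist x (frontier U) < uniqRadius (frontier U) / 2) :
    ‖fderiv ℝ (reflAcross (frontier U)) x‖ ≤ 3 := by
  have hx0 := infDist_frontier_pos hU hfne hx
  have hM := B.norm_smul_fderiv_nuGeo_le_one hU hfne hfc hx hxL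
  set a := nearestPt (frontier U) x with hxa
  have ha : a ∈ frontier U := (nearestPt_spec hfc hfne x).1
  obtain ⟨P, hP, -, hν, hPv⟩ :=
    B.exists_hasFDerivAt_nearestPt_of_mem hU hfne hfc hx hxa.symm (by linarith)
  set h := infDist x (frontier U) with hh
  have hσ : HasFDerivAt (reflAcross (frontier U))
      ((2 : ℝ) • P - ContinuousLinearMap.id ℝ (Euc n)) x :=
    (hP.const_smul (2 : ℝ)).sub (hasFDerivAt_id x)
  rw [hσ.fderiv]
  refine ContinuousLinearMap.opNorm_le_bound _ (by norm_num) fun v => ?_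
  have hMv : ‖h • fderiv ℝ B.nu a (P v)‖ ≤ ‖v‖ := by
    have := ContinuousLinearMap.le_of_opNorm_le _ hM v
    rwa [hν.fderiv, one_mul] at this
  have hrefl : ‖v - (2 * inner ℝ (B.nu a) v) • B.nu a‖ = ‖v‖ := by
    rw [← sq_eq_sq₀ (norm_nonneg _) (norm_nonneg _), norm_sub_sq_real, real_inner_smul_right,
      norm_smul, B.norm_nu_of_mem ha, mul_one, Real.norm_eq_abs, sq_abs, real_inner_comm]
    ring
  have hsplit : ((2 : ℝ) • P - ContinuousLinearMap.id ℝ (Euc n)) v =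
      (v - (2 * inner ℝ (B.nu a) v) • B.nu a) + (2 : ℝ) • h • fderiv ℝ B.nu a (P v) := by
    rw [sub_apply, smul_apply,
      ContinuousLinearMap.id_apply]
    nth_rewrite 1 [(hPv v).2]
    module
  calc _ = ‖(v - (2 * inner ℝ (B.nu a) v) • B.nu a) +
        (2 : ℝ) • h • fderiv ℝ B.nu a (P v)‖ := by rw [hsplit]
    _ ≤ ‖v‖ + 2 * ‖v‖ := by
      refine (norm_add_le _ _).trans (add_le_add hrefl.le ?_)
      rw [norm_smul, Real.norm_two]
      linarith
    _ = 3 * ‖v‖ := by ring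

end CkDomain

end Corona

/-- Lemma B.1: for `x` in the corona, with `a = π(x)`,
`h |D²h_x|_bil = |h dν_a (Id − h dν_a)⁻¹|_op`; in particular `h |D²h|_bil ≤ 1` and
`|dσ|_op ≤ 3` on the sub-corona `ω_{1/2}`. -/
theorem stmt15 (n : ℕ) (U : Set (Euc n)) (hU : IsOpen U)
    (hfne : (frontier U).Nonempty) (hfc : IsCompact (frontier U))
    (B : CkDomain n 3 U) (hL : 0 < uniqRadius (frontier U)) :
    (∀ x ∈ U, 0 < infDist x (frontier U) →
      infDist x (frontier U) < uniqRadius (frontier U) →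
      infDist x (frontier U) *
          ‖fderiv ℝ (fderiv ℝ (fun y : Euc n => infDist y (frontier U))) x‖ =
        ‖(infDist x (frontier U) • fderiv ℝ B.nuGeo (nearestPt (frontier U) x)) *
          Ring.inverse ((1 : Euc n →L[ℝ] Euc n) -
            infDist x (frontier U) • fderiv ℝ B.nuGeo (nearestPt (frontier U) x))‖) ∧
    (∀ x ∈ U, 0 < infDist x (frontier U) →
      infDist x (frontier U) < uniqRadius (frontier U) / 2 →
      infDist x (frontier U) *
          ‖fderiv ℝ (fderiv ℝ (fun y : Euc n => infDist y (frontier U))) x‖ ≤ 1 ∧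
      ‖fderiv ℝ (reflAcross (frontier U)) x‖ ≤ 3) := by
  have hdist : ∀ x ∈ U, infDist x (frontier U) < uniqRadius (frontier U) →
      infDist x (frontier U) *
          ‖fderiv ℝ (fderiv ℝ (fun y : Euc n => infDist y (frontier U))) x‖ =
        ‖infDist x (frontier U) • fderiv ℝ B.nuGeo x‖ := fun x hx hxL => by
    rw [B.norm_fderiv_fderiv_infDist hU hfne hfc hx hxL, norm_smul,
      Real.norm_of_nonneg infDist_nonneg]
  refine ⟨fun x hx _ hxL => ?_, fun x hx _ hxL => ⟨?_, ?_⟩⟩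
  · rw [hdist x hx hxL, B.fderiv_nuGeo_eq hU hfne hfc hx rfl hxL]
    rfl
  · rw [hdist x hx (by linarith)]
    exact B.norm_smul_fderiv_nuGeo_le_one hU hfne hfc hx hxL
  · exact B.norm_fderiv_reflAcross_le hU hfne hfc hx hxL

end
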